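/- Let r = (r_1,…,r_d) ∈ (0,∞)^d be a polyradius, let f be a holomorphic function on the polydisc D_r, let m ∈ ℕ and j ∈ {1,…,d}. Then ‖∂f/∂x_j‖_{m+1} ≤ e·(m+1)·(∏_{i≠j} r_i/2)·‖f‖_m, where e is Euler's number and the inequality is understood in [0,∞]. -/

import Mathlib

/- Infrastructure: polydiscs in ℂ^d, the modified distance-to-boundary
function d_r, and Nagumo norms (with values in [0,∞]). -/

open scoped BigOperators ENNReal
noncomputable section

/-- The open polydisc of polyradius `r` centered at the origin of ℂ^d. -/
def polydisc {d : ℕ} (r : Fin d → ℝ) : Set (Fin d → ℂ) := {x | ∀ i, ‖x i‖ < r i}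

/-- The modified boundary distance: d_r(x) = r − |x| if |x| ≥ r/2, and r/2 if |x| < r/2. -/
def dDist (r : ℝ) (x : ℂ) : ℝ := if ‖x‖ < r / 2 then r / 2 else r - ‖x‖

/-- The Nagumo norm of index `m` of a function on the polydisc of polyradius `r`:
‖f‖_m = sup_{x ∈ D_r} |f(x)| d_{r_1}(x_1)^m ⋯ d_{r_d}(x_d)^m ∈ [0,∞]. -/
def nagumo {d : ℕ} (r : Fin d → ℝ) (m : ℕ) (f : (Fin d → ℂ) → ℂ) : ℝ≥0∞ :=
  ⨆ x ∈ polydisc r, ENNReal.ofReal (‖f x‖ * ∏ i, dDist (r i) (x i) ^ m)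

theorem dDist_eq_min (r : ℝ) (x : ℂ) : dDist r x = min (r / 2) (r - ‖x‖) := by
  unfold dDist
  split_ifs with h
  · rw [min_eq_left]; linarith
  · rw [min_eq_right]; linarith

theorem dDist_pos {r : ℝ} {x : ℂ} (hr : 0 < r) (hx : ‖x‖ < r) : 0 < dDist r x := by
  rw [dDist_eq_min]
  exact lt_min (by linarith) (by linarith)

theorem dDist_le_half (r : ℝ) (x : ℂ) : dDist r x ≤ r / 2 := by
  rw [dDist_eq_min]
  exact min_le_left _ _

theorem dDist_le_sub_norm (r : ℝ) (x : ℂ) : dDist r x ≤ r - ‖x‖ := by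
  rw [dDist_eq_min]
  exact min_le_right _ _

theorem dDist_sub_norm_sub_le (r : ℝ) (x y : ℂ) : dDist r x - ‖y - x‖ ≤ dDist r y := by
  rw [dDist_eq_min r y]
  have h := norm_sub_norm_le y x
  exact le_min (by linarith [dDist_le_half r x, norm_nonneg (y - x)])
    (by linarith [dDist_le_sub_norm r x])

theorem isOpen_polydisc {d : ℕ} (r : Fin d → ℝ) : IsOpen (polydisc r) := by
  simp only [polydisc, Set.ofPred_forall]
  exact isOpen_iInter_of_finite fun i =>
    isOpen_lt (continuous_apply i).norm continuous_const

theorem update_mem_polydisc {d : ℕ} {r : Fin d → ℝ} {x : Fin d → ℂ} (hx : x ∈ polydisc r)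
    {j : Fin d} {z : ℂ} (hz : ‖z‖ < r j) : Function.update x j z ∈ polydisc r := by
  intro i
  rcases eq_or_ne i j with rfl | hij
  · simpa using hz
  · simpa [hij] using hx i

theorem norm_mul_prod_dDist_le_toReal_nagumo {d : ℕ} {r : Fin d → ℝ} {m : ℕ}
    {f : (Fin d → ℂ) → ℂ} (hfin : nagumo r m f ≠ ∞) {x : Fin d → ℂ} (hx : x ∈ polydisc r) :
    ‖f x‖ * ∏ i, dDist (r i) (x i) ^ m ≤ (nagumo r m f).toReal := by
  rw [← ENNReal.ofReal_le_iff_le_toReal hfin]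
  exact le_iSup₂ (f := fun x (_ : x ∈ polydisc r) =>
    ENNReal.ofReal (‖f x‖ * ∏ i, dDist (r i) (x i) ^ m)) x hx

theorem hasDerivAt_comp_update {d : ℕ} {r : Fin d → ℝ} {f : (Fin d → ℂ) → ℂ}
    (hf : DifferentiableOn ℂ f (polydisc r)) {x : Fin d → ℂ} (hx : x ∈ polydisc r) {j : Fin d}
    {z : ℂ} (hz : ‖z‖ < r j) :
    HasDerivAt (fun w => f (Function.update x j w))
      (fderiv ℂ f (Function.update x j z) (Pi.single j 1)) z :=
  (hf.differentiableAt ((isOpen_polydisc r).mem_nhds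
    (update_mem_polydisc hx hz))).hasFDerivAt.comp_hasDerivAt z (hasDerivAt_update x j z)

/-- The Cauchy estimate on a circle of radius `δ / (m + 2)`, for a function which is
`O((distance to the boundary)⁻ᵐ)`. -/
theorem norm_deriv_mul_pow_le {g : ℂ → ℂ} {c : ℂ} {δ A : ℝ} {m : ℕ} (hδ : 0 < δ) (hA : 0 ≤ A)
    (hg : DifferentiableOn ℂ g (Metric.ball c δ))
    (hbound : ∀ z ∈ Metric.ball c δ, ‖g z‖ * (δ - ‖z - c‖) ^ m ≤ A) :
    ‖deriv g c‖ * δ ^ (m + 1) ≤ Real.exp 1 * (m + 1) * A := by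
  have hm : (0 : ℝ) < m + 1 := by positivity
  have hm2 : (0 : ℝ) < m + 2 := by positivity
  set R : ℝ := δ / (m + 2) with hR
  have hRpos : 0 < R := by positivity
  have hδR : δ - R = δ * (m + 1) / (m + 2) := by rw [hR]; field_simp; ring
  have hδRpos : 0 < δ - R := by rw [hδR]; positivity
  have hcl : DiffContOnCl ℂ g (Metric.ball c R) := by
    refine (hg.mono ?_).diffContOnCl
    exact Metric.closure_ball_subset_closedBall.trans
      (Metric.closedBall_subset_ball (by linarith))
  have hcauchy : ‖deriv g c‖ ≤ A / (δ - R) ^ m / R := by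
    refine Complex.norm_deriv_le_of_forall_mem_sphere_norm_le hRpos hcl fun z hz => ?_
    have hzR : ‖z - c‖ = R := by simpa using hz
    rw [le_div_iff₀ (by positivity)]
    simpa [hzR] using hbound z (by rw [mem_ball_iff_norm, hzR]; linarith)
  have hexp : (1 + 1 / ((m : ℝ) + 1)) ^ (m + 1) ≤ Real.exp 1 := by
    calc (1 + 1 / ((m : ℝ) + 1)) ^ (m + 1) ≤ Real.exp (1 / ((m : ℝ) + 1)) ^ (m + 1) := by
          gcongr
          linarith [Real.add_one_le_exp (1 / ((m : ℝ) + 1))]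
      _ = Real.exp 1 := by
          rw [← Real.exp_nat_mul]
          congr 1
          push_cast
          field_simp
  calc ‖deriv g c‖ * δ ^ (m + 1) ≤ A / (δ - R) ^ m / R * δ ^ (m + 1) := by gcongr
    _ = (1 + 1 / ((m : ℝ) + 1)) ^ (m + 1) * (m + 1) * A := by
        rw [hδR, hR, show (1 : ℝ) + 1 / (m + 1) = (m + 2) / (m + 1) by field_simp; ring]
        simp only [div_pow, mul_pow, pow_succ]
        field_simp
    _ ≤ Real.exp 1 * (m + 1) * A := by gcongr

/-- Proposition on Nagumo norms, part (2).
For f holomorphic on the polydisc D_r: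
‖∂f/∂x_j‖_{m+1} ≤ e·(m+1)·(∏_{i≠j} r_i/2)·‖f‖_m, in [0,∞].
Here ∂f/∂x_j is realized as x ↦ (fderiv ℂ f x) (Pi.single j 1). -/
theorem stmt5 {d : ℕ} (hd : 1 ≤ d) (r : Fin d → ℝ) (hr : ∀ i, 0 < r i)
    (f : (Fin d → ℂ) → ℂ) (hf : DifferentiableOn ℂ f (polydisc r))
    (m : ℕ) (j : Fin d) :
    nagumo r (m + 1) (fun x => fderiv ℂ f x (Pi.single j 1)) ≤
      ENNReal.ofReal (Real.exp 1 * (m + 1) * ∏ i ∈ Finset.univ.erase j, r i / 2) *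
        nagumo r m f := by
  set C : ℝ := Real.exp 1 * (m + 1) * ∏ i ∈ Finset.univ.erase j, r i / 2 with hC
  have hCpos : 0 < C :=
    mul_pos (by positivity) (Finset.prod_pos fun i _ => half_pos (hr i))
  by_cases hfin : nagumo r m f = ∞
  · rw [hfin, ENNReal.mul_top (by simpa using hCpos)]
    exact le_top
  refine iSup₂_le fun x hx => ?_
  rw [← ENNReal.ofReal_toReal hfin, ← ENNReal.ofReal_mul hCpos.le]
  refine ENNReal.ofReal_le_ofReal ?_
  set M := (nagumo r m f).toReal
  set P : ℝ := ∏ i ∈ Finset.univ.erase j, dDist (r i) (x i) with hP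
  have hPpos : 0 < P := Finset.prod_pos fun i _ => dDist_pos (hr i) (hx i)
  have hPle : P ≤ ∏ i ∈ Finset.univ.erase j, r i / 2 :=
    Finset.prod_le_prod (fun i _ => (dDist_pos (hr i) (hx i)).le) fun i _ => dDist_le_half _ _
  have hsplit (n : ℕ) (z : ℂ) :
      ∏ i, dDist (r i) (Function.update x j z i) ^ n = dDist (r j) z ^ n * P ^ n := by
    rw [← Finset.mul_prod_erase _ _ (Finset.mem_univ j), Function.update_self, hP,
      ← Finset.prod_pow]
    congr 1
    refine Finset.prod_congr rfl fun i hi => ?_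
    rw [Function.update_of_ne (Finset.ne_of_mem_erase hi)]
  have hball {z : ℂ} (hz : z ∈ Metric.ball (x j) (dDist (r j) (x j))) : ‖z‖ < r j := by
    rw [mem_ball_iff_norm] at hz
    linarith [norm_sub_norm_le z (x j), dDist_le_sub_norm (r j) (x j)]
  have hderiv := norm_deriv_mul_pow_le (g := fun z => f (Function.update x j z))
    (A := M / P ^ m) (m := m) (dDist_pos (hr j) (hx j))
    (div_nonneg ENNReal.toReal_nonneg (by positivity))
    (fun z hz =>
      (hasDerivAt_comp_update hf hx (hball hz)).differentiableAt.differentiableWithinAt)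
    (fun z hz => by
      have h := norm_mul_prod_dDist_le_toReal_nagumo hfin (update_mem_polydisc hx (hball hz))
      rw [hsplit, ← mul_assoc] at h
      rw [le_div_iff₀ (by positivity)]
      refine le_trans ?_ h
      rw [mem_ball_iff_norm] at hz
      have hnonneg := sub_nonneg.2 hz.le
      gcongr
      exact dDist_sub_norm_sub_le _ _ _)
  rw [(hasDerivAt_comp_update hf hx (hx j)).deriv, Function.update_eq_self] at hderiv
  have hprod := hsplit (m + 1) (x j)
  rw [Function.update_eq_self] at hprod
  rw [hprod, ← mul_assoc]
  calc _ ≤ Real.exp 1 * (m + 1) * (M / P ^ m) * P ^ (m + 1) := by gcongr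
    _ = Real.exp 1 * (m + 1) * P * M := by rw [pow_succ]; field_simp
    _ ≤ C * M := by rw [hC]; gcongr
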